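/- arXiv:1108.0817 — 2 statements merged into one kernel-verified Lean document; each statement's English description precedes it below -/
import Mathlib

section
/- Let S be a simple system over R = F[x₁,…,x_n] and 1 ≤ k ≤ n such that S_{x_k} consists of one inequation p≠0. Then for every b ∈ Sol(S_{<x_k}) ⊆ F̄^{k−1}, the set {a ∈ F̄ : (b,a) ∈ Sol(S_{≤x_k})} is the complement in F̄ of a set of exactly mdeg(p) elements; in particular all but finitely many a ∈ F̄ extend b to a solution of S_{≤x_k}. -/
open MvPolynomial

/-- An algebraic system over `F[x₁,…,xₙ]`: a finite set of equations `p = 0`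
and a finite set of inequations `p ≠ 0`. -/
structure AlgSystem (F : Type*) [Field F] (n : ℕ) where
  eqs : Finset (MvPolynomial (Fin n) F)
  ineqs : Finset (MvPolynomial (Fin n) F)

variable {F : Type*} [Field F] [CharZero F] {n : ℕ}

/-- `k` is the leader of `p`: the largest variable occurring in `p`. -/
def IsLeader (p : MvPolynomial (Fin n) F) (k : Fin n) : Prop :=
  k ∈ p.vars ∧ ∀ j ∈ p.vars, j ≤ k

/-- membership of a polynomial in a system (as an equation or an inequation). -/
def AlgSystem.Mem (S : AlgSystem F n) (p : MvPolynomial (Fin n) F) : Prop :=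
  p ∈ S.eqs ∨ p ∈ S.ineqs

/-- `a ∈ Sol(S)`: `a` satisfies all equations and inequations of `S`. -/
def Sol (S : AlgSystem F n) (a : Fin n → AlgebraicClosure F) : Prop :=
  (∀ p ∈ S.eqs, aeval a p = 0) ∧ (∀ p ∈ S.ineqs, aeval a p ≠ 0)

/-- `a` is a solution of the subsystem `S_{<x_k}` of all members of `S` whose
variables are all `< x_k` (only the coordinates `< k` of `a` matter). -/
def SolBelow (S : AlgSystem F n) (k : Fin n) (a : Fin n → AlgebraicClosure F) : Prop :=
  (∀ p ∈ S.eqs, (∀ j ∈ p.vars, j < k) → aeval a p = 0) ∧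
  (∀ p ∈ S.ineqs, (∀ j ∈ p.vars, j < k) → aeval a p ≠ 0)

/-- `a` is a solution of the subsystem `S_{≤x_k}` of all members of `S` whose
variables are all `≤ x_k` (only the coordinates `≤ k` of `a` matter). -/
def SolUpTo (S : AlgSystem F n) (k : Fin n) (a : Fin n → AlgebraicClosure F) : Prop :=
  (∀ p ∈ S.eqs, (∀ j ∈ p.vars, j ≤ k) → aeval a p = 0) ∧
  (∀ p ∈ S.ineqs, (∀ j ∈ p.vars, j ≤ k) → aeval a p ≠ 0)

/-- `φ_{<x_k,a}(p)`: the univariate polynomial over `F̄` obtained from `p` by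
substituting `a i` for `x_i` (`i ≠ k`) and keeping `x_k` as the variable. -/
noncomputable def uni (a : Fin n → AlgebraicClosure F) (k : Fin n)
    (p : MvPolynomial (Fin n) F) : Polynomial (AlgebraicClosure F) :=
  aeval (fun i => if i = k then (Polynomial.X : Polynomial (AlgebraicClosure F))
    else Polynomial.C (a i)) p

/-- The initial of `p` with respect to the variable `x_k`: the leading coefficient
of `p` regarded as a univariate polynomial in `x_k`. -/
noncomputable def initOf (p : MvPolynomial (Fin n) F) (k : Fin n) :
    MvPolynomial (Fin n) F :=
  ∑ m ∈ p.support.filter (fun m => m k = p.degreeOf k),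
    monomial (m.erase k) (coeff m p)

/-- Triangularity: at most one member of `S` has leader `x_k`, for each `k`,
and `S` contains no constant polynomial. -/
def Triangular (S : AlgSystem F n) : Prop :=
  (∀ k : Fin n, ∀ p, S.Mem p → ∀ q, S.Mem q → IsLeader p k → IsLeader q k → p = q) ∧
  (∀ k : Fin n, ∀ p, IsLeader p k → ¬(p ∈ S.eqs ∧ p ∈ S.ineqs)) ∧
  (∀ p, S.Mem p → p.vars.Nonempty)

/-- Non-vanishing initials: for every member `p` of `S` with leader `x_k` and every
solution `a` of `S_{<x_k}`, `init(p)` does not vanish at `a`. -/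
def NonVanishingInitials (S : AlgSystem F n) : Prop :=
  ∀ k : Fin n, ∀ p, S.Mem p → IsLeader p k →
    ∀ a : Fin n → AlgebraicClosure F, SolBelow S k a → aeval a (initOf p k) ≠ 0

/-- Square-freeness: for every member `p` of `S` with leader `x_k` and every
solution `a` of `S_{<x_k}`, the univariate polynomial `φ_{<x_k,a}(p)` is squarefree. -/
def SquarefreeCond (S : AlgSystem F n) : Prop :=
  ∀ k : Fin n, ∀ p, S.Mem p → IsLeader p k →
    ∀ a : Fin n → AlgebraicClosure F, SolBelow S k a → Squarefree (uni a k p)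

/-- A simple system. -/
def Simple (S : AlgSystem F n) : Prop :=
  Triangular S ∧ NonVanishingInitials S ∧ SquarefreeCond S

theorem uni_monomial_aux (a : Fin n → AlgebraicClosure F) (k : Fin n) (m : Fin n →₀ ℕ) (r : F) :
    uni a k (monomial m r) =
      Polynomial.monomial (m k) (aeval a (monomial (m.erase k) r)) := by
  have h1 : monomial m r = monomial (m.erase k) r * X k ^ (m k) := by
    rw [← monomial_add_single, Finsupp.erase_add_single]
  have h2 : uni a k (monomial (m.erase k) r)
      = Polynomial.C (aeval a (monomial (m.erase k) r)) := by
    unfold uni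
    rw [aeval_monomial, aeval_monomial, map_mul, Finsupp.prod, Finsupp.prod, map_prod]
    congr 1
    refine Finset.prod_congr rfl fun i hi => ?_
    have : i ≠ k := by
      rintro rfl
      simp at hi
    simp [this]
  have h3 : uni a k (X k) = Polynomial.X := by simp [uni]
  calc uni a k (monomial m r) = uni a k (monomial (m.erase k) r) * uni a k (X k) ^ (m k) := by
        conv_lhs => rw [h1]
        simp only [uni, map_mul, map_pow]
    _ = _ := by rw [h2, h3, Polynomial.C_mul_X_pow_eq_monomial]

theorem uni_eq_sum_aux (a : Fin n → AlgebraicClosure F) (k : Fin n) (p : MvPolynomial (Fin n) F) :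
    uni a k p = ∑ m ∈ p.support,
      Polynomial.monomial (m k) (aeval a (monomial (m.erase k) (coeff m p))) := by
  conv_lhs => rw [p.as_sum]
  rw [uni, map_sum]
  exact Finset.sum_congr rfl fun m _ => uni_monomial_aux a k m _

theorem uni_coeff_aux (a : Fin n → AlgebraicClosure F) (k : Fin n) (p : MvPolynomial (Fin n) F) :
    (uni a k p).coeff (p.degreeOf k) = aeval a (initOf p k) := by
  rw [uni_eq_sum_aux, initOf, map_sum, Polynomial.finsetSum_coeff, Finset.sum_filter]
  exact Finset.sum_congr rfl fun m _ => by rw [Polynomial.coeff_monomial]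

theorem uni_natDegree_aux (a : Fin n → AlgebraicClosure F) (k : Fin n)
    (p : MvPolynomial (Fin n) F) (h : aeval a (initOf p k) ≠ 0) :
    (uni a k p).natDegree = p.degreeOf k := by
  apply le_antisymm
  · rw [uni_eq_sum_aux]
    refine Polynomial.natDegree_sum_le_of_forall_le _ _ fun m hm => ?_
    exact (Polynomial.natDegree_monomial_le _).trans (monomial_le_degreeOf k hm)
  · exact Polynomial.le_natDegree_of_ne_zero (by rwa [uni_coeff_aux])

theorem uni_eval_aux (a : Fin n → AlgebraicClosure F) (k : Fin n)
    (p : MvPolynomial (Fin n) F) (c : AlgebraicClosure F) :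
    (uni a k p).eval c = aeval (Function.update a k c) p := by
  induction p using MvPolynomial.induction_on with
  | C r => simp [uni, Polynomial.algebraMap_apply]
  | add p q hp hq =>
    simp only [uni, map_add, Polynomial.eval_add] at *
    rw [hp, hq]
  | mul_X p i hp =>
    simp only [uni, map_mul, Polynomial.eval_mul] at *
    rw [hp]
    congr 1
    by_cases hi : i = k
    · subst hi; simp
    · simp [hi]

theorem aeval_update_aux (a : Fin n → AlgebraicClosure F) (k : Fin n)
    (q : MvPolynomial (Fin n) F) (c : AlgebraicClosure F) (h : ∀ j ∈ q.vars, j < k) :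
    aeval (Function.update a k c) q = aeval a q := by
  apply eval₂Hom_congr' rfl _ rfl
  intro i hi _
  rw [Function.update_of_ne (h i hi).ne]

/-- If `S` is simple and `S_{x_k}` consists of one inequation `p ≠ 0`, then for every
solution `b` of `S_{<x_k}` the set of extensions of `b` to a solution of `S_{≤x_k}`
is the complement of a set of exactly `mdeg(p)` elements; in particular all but
finitely many `c ∈ F̄` extend `b` to a solution of `S_{≤x_k}`. -/
theorem simple_inequation_fiber_cocard (S : AlgSystem F n) (hS : Simple S) (k : Fin n)
    (p : MvPolynomial (Fin n) F) (hp : p ∈ S.ineqs) (hld : IsLeader p k)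
    (a : Fin n → AlgebraicClosure F) (ha : SolBelow S k a) :
    (∃ B : Finset (AlgebraicClosure F), B.card = p.degreeOf k ∧
        ∀ c : AlgebraicClosure F, SolUpTo S k (Function.update a k c) ↔ c ∉ B) ∧
      {c : AlgebraicClosure F | ¬ SolUpTo S k (Function.update a k c)}.Finite := by
  obtain ⟨⟨ht1, ht2, ht3⟩, hni, hsf⟩ := hS
  have hmem : S.Mem p := Or.inr hp
  have hin := hni k p hmem hld a ha
  have hsq := hsf k p hmem hld a ha
  have hdeg := uni_natDegree_aux a k p hin
  have hne : uni a k p ≠ 0 := hsq.ne_zero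
  have key : ∀ c : AlgebraicClosure F, SolUpTo S k (Function.update a k c) ↔
      aeval (Function.update a k c) p ≠ 0 := by
    intro c
    have hlt : ∀ q, S.Mem q → q ≠ p → (∀ j ∈ q.vars, j ≤ k) → ∀ j ∈ q.vars, j < k := by
      intro q hq hqp hle j hj
      refine lt_of_le_of_ne (hle j hj) ?_
      rintro rfl
      exact hqp (ht1 j q hq p hmem ⟨hj, hle⟩ hld)
    constructor
    · intro h
      exact h.2 p hp hld.2
    · intro h
      refine ⟨fun q hq hle => ?_, fun q hq hle => ?_⟩
      · have hqp : q ≠ p := by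
          rintro rfl
          exact ht2 k q hld ⟨hq, hp⟩
        have := hlt q (Or.inl hq) hqp hle
        rw [aeval_update_aux a k q c this]
        exact ha.1 q hq this
      · by_cases hqp : q = p
        · rwa [hqp]
        · have := hlt q (Or.inr hq) hqp hle
          rw [aeval_update_aux a k q c this]
          exact ha.2 q hq this
  classical
  have hB : ∀ c : AlgebraicClosure F, SolUpTo S k (Function.update a k c) ↔
      c ∉ (uni a k p).roots.toFinset := by
    intro c
    rw [key, Multiset.mem_toFinset, Polynomial.mem_roots hne, Polynomial.IsRoot.def, uni_eval_aux]
  refine ⟨⟨(uni a k p).roots.toFinset, ?_, hB⟩, ?_⟩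
  · have hnd : (uni a k p).roots.Nodup :=
      Polynomial.nodup_roots (PerfectField.separable_iff_squarefree.mpr hsq)
    rw [Multiset.toFinset_card_of_nodup hnd, ← hdeg]
    exact (IsAlgClosed.splits (uni a k p)).natDegree_eq_card_roots.symm
  · refine (uni a k p).roots.toFinset.finite_toSet.subset fun c hc => ?_
    by_contra h
    exact hc ((hB c).mpr h)
end

section
/- Let S be a simple system over R = F[x₁,…,x_n] and let p ∈ R be a polynomial that is reduced with respect to the equations of S, i.e., for every k such that S_{x_k} consists of an equation g=0, the degree of p in the variable x_k is strictly smaller than mdeg(g). If φ_a(p) = 0 for every a ∈ Sol(S), then p = 0. -/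
open MvPolynomial

variable {F : Type*} [Field F] [CharZero F] {n : ℕ}

/-- Coefficient of `x_k ^ j` in `p`. -/
noncomputable def cf (p : MvPolynomial (Fin n) F) (k : Fin n) (j : ℕ) :
    MvPolynomial (Fin n) F :=
  ∑ m ∈ p.support.filter (fun m => m k = j), monomial (m.erase k) (coeff m p)

theorem coeff_cf (p : MvPolynomial (Fin n) F) (k : Fin n) (m : Fin n →₀ ℕ) :
    coeff (m.erase k) (cf p k (m k)) = coeff m p := by
  classical
  unfold cf
  rw [coeff_sum]
  simp only [coeff_monomial]
  rw [Finset.sum_eq_single m]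
  · simp
  · intro b hb hbm
    rw [if_neg]
    intro h
    apply hbm
    ext i
    by_cases hi : i = k
    · subst hi; exact (Finset.mem_filter.1 hb).2
    · have := DFunLike.congr_fun h i
      simpa [Finsupp.erase_ne hi] using this
  · intro h
    simpa using h

theorem support_cf (p : MvPolynomial (Fin n) F) (k : Fin n) (j : ℕ) (m : Fin n →₀ ℕ)
    (hm : m ∈ (cf p k j).support) : ∃ b ∈ p.support, m = b.erase k := by
  classical
  unfold cf at hm
  obtain ⟨b, hb, h⟩ := Finset.mem_biUnion.1 (support_sum hm)
  refine ⟨b, (Finset.mem_filter.1 hb).1, ?_⟩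
  have := support_monomial_subset h
  simpa using this

theorem degreeOf_cf (p : MvPolynomial (Fin n) F) (k : Fin n) (j : ℕ) (i : Fin n) :
    (cf p k j).degreeOf i ≤ p.degreeOf i := by
  rw [degreeOf_le_iff]
  intro m hm
  obtain ⟨b, hb, rfl⟩ := support_cf p k j m hm
  refine le_trans ?_ (monomial_le_degreeOf i hb)
  by_cases hi : i = k
  · subst hi; simp
  · simp [Finsupp.erase_ne hi]

theorem vars_cf (p : MvPolynomial (Fin n) F) (k : Fin n) (j : ℕ) (i : Fin n)
    (h : i ∈ (cf p k j).vars) : i ∈ p.vars ∧ i ≠ k := by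
  obtain ⟨m, hm, hi⟩ := (mem_vars i).1 h
  obtain ⟨b, hb, rfl⟩ := support_cf p k j m hm
  by_cases hik : i = k
  · subst hik; simp at hi
  · refine ⟨(mem_vars i).2 ⟨b, hb, ?_⟩, hik⟩
    simpa [Finsupp.erase_ne hik, hik] using hi

theorem uni_coeff (a : Fin n → AlgebraicClosure F) (k : Fin n)
    (p : MvPolynomial (Fin n) F) (j : ℕ) :
    (uni a k p).coeff j = aeval a (cf p k j) := by
  classical
  unfold uni cf
  rw [aeval_def, eval₂_eq', Polynomial.finsetSum_coeff, map_sum, Finset.sum_filter]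
  refine Finset.sum_congr rfl fun m _ => ?_
  have key : (∏ i, (if i = k then (Polynomial.X : Polynomial (AlgebraicClosure F))
      else Polynomial.C (a i)) ^ m i)
      = Polynomial.C (∏ i, a i ^ (m.erase k) i) * Polynomial.X ^ m k := by
    rw [← Finset.mul_prod_erase Finset.univ _ (Finset.mem_univ k),
      ← Finset.mul_prod_erase Finset.univ (fun i => a i ^ (m.erase k) i) (Finset.mem_univ k)]
    simp only [if_true, Finsupp.erase_same, pow_zero, one_mul, map_prod, map_pow]
    rw [mul_comm]
    congr 1
    refine Finset.prod_congr rfl fun i hi => ?_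
    have : i ≠ k := Finset.ne_of_mem_erase hi
    simp [this, Finsupp.erase_ne this]
  rw [key, IsScalarTower.algebraMap_apply F (AlgebraicClosure F) (Polynomial (AlgebraicClosure F)),
    Polynomial.algebraMap_eq, ← mul_assoc, ← Polynomial.C_mul, Polynomial.coeff_C_mul_X_pow]
  by_cases h : j = m k
  · rw [if_pos h, if_pos h.symm, aeval_monomial, Finsupp.prod_fintype _ _ (by simp)]
  · rw [if_neg h, if_neg (Ne.symm h)]

theorem uni_eval (a : Fin n → AlgebraicClosure F) (k : Fin n)
    (p : MvPolynomial (Fin n) F) (t : AlgebraicClosure F) :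
    (uni a k p).eval t = aeval (Function.update a k t) p := by
  unfold uni
  induction p using MvPolynomial.induction_on with
  | C c =>
    simp [IsScalarTower.algebraMap_apply F (AlgebraicClosure F) (Polynomial (AlgebraicClosure F))]
  | add p q hp hq => simp [hp, hq]
  | mul_X p i hp =>
    rw [map_mul, map_mul, Polynomial.eval_mul, hp, aeval_X, aeval_X]
    by_cases h : i = k
    · subst h; simp
    · simp [h]

theorem aeval_update_of_notMem (a : Fin n → AlgebraicClosure F) (k : Fin n)
    (p : MvPolynomial (Fin n) F) (t : AlgebraicClosure F) (h : k ∉ p.vars) :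
    aeval (Function.update a k t) p = aeval a p := by
  refine eval₂Hom_congr' rfl ?_ rfl
  intro i hi _
  have : i ≠ k := fun e => h (e ▸ hi)
  simp [this]

theorem cf_eq_zero (p : MvPolynomial (Fin n) F) (k : Fin n) (j : ℕ)
    (h : p.degreeOf k < j) : cf p k j = 0 := by
  unfold cf
  rw [Finset.filter_false_of_mem, Finset.sum_empty]
  intro m hm e
  have := monomial_le_degreeOf k hm
  omega

theorem uni_natDegree_le (a : Fin n → AlgebraicClosure F) (k : Fin n)
    (p : MvPolynomial (Fin n) F) : (uni a k p).natDegree ≤ p.degreeOf k := by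
  rw [Polynomial.natDegree_le_iff_coeff_eq_zero]
  intro j hj
  rw [uni_coeff, cf_eq_zero p k j hj, map_zero]

/-- Solutions of the part of the system with all variables of index `< k`. -/
def SB (S : AlgSystem F n) (k : ℕ) (a : Fin n → AlgebraicClosure F) : Prop :=
  (∀ p ∈ S.eqs, (∀ j ∈ p.vars, (j : ℕ) < k) → aeval a p = 0) ∧
  (∀ p ∈ S.ineqs, (∀ j ∈ p.vars, (j : ℕ) < k) → aeval a p ≠ 0)

theorem SB_update (S : AlgSystem F n) (k : Fin n) (a : Fin n → AlgebraicClosure F)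
    (ha : SB S k a) (t : AlgebraicClosure F)
    (h1 : ∀ g ∈ S.eqs, IsLeader g k → (uni a k g).eval t = 0)
    (h2 : ∀ g ∈ S.ineqs, IsLeader g k → (uni a k g).eval t ≠ 0) :
    SB S (k + 1) (Function.update a k t) := by
  have aux : ∀ g : MvPolynomial (Fin n) F, k ∉ g.vars → (∀ j ∈ g.vars, (j : ℕ) < k + 1) →
      ∀ j ∈ g.vars, (j : ℕ) < k := by
    intro g hk hg j hj
    have h3 := hg j hj
    have h4 : j ≠ k := fun e => hk (e ▸ hj)
    have h5 : (j : ℕ) ≠ k := fun e => h4 (Fin.ext e)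
    omega
  have aux2 : ∀ g : MvPolynomial (Fin n) F, k ∈ g.vars → (∀ j ∈ g.vars, (j : ℕ) < k + 1) →
      IsLeader g k := fun g hk hg =>
    ⟨hk, fun j hj => by have := hg j hj; rw [Fin.le_def]; omega⟩
  constructor
  · intro g hg hv
    by_cases hk : k ∈ g.vars
    · rw [← uni_eval]; exact h1 g hg (aux2 g hk hv)
    · rw [aeval_update_of_notMem _ _ _ _ hk]; exact ha.1 g hg (aux g hk hv)
  · intro g hg hv
    by_cases hk : k ∈ g.vars
    · rw [← uni_eval]; exact h2 g hg (aux2 g hk hv)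
    · rw [aeval_update_of_notMem _ _ _ _ hk]; exact ha.2 g hg (aux g hk hv)

theorem uni_eq_zero (S : AlgSystem F n) (hS : Simple S) (k : Fin n)
    (p : MvPolynomial (Fin n) F)
    (hred : ∀ g ∈ S.eqs, IsLeader g k → p.degreeOf k < g.degreeOf k)
    (hvan : ∀ a : Fin n → AlgebraicClosure F, SB S (k + 1) a → aeval a p = 0)
    (a : Fin n → AlgebraicClosure F) (ha : SB S k a) : uni a k p = 0 := by
  classical
  obtain ⟨⟨ht1, ht2, -⟩, hini, hsq⟩ := hS
  have hb : SolBelow S k a := ha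
  by_cases hE : ∃ g ∈ S.eqs, IsLeader g k
  · obtain ⟨g, hg, hgk⟩ := hE
    have hs : Squarefree (uni a k g) := hsq k g (Or.inl hg) hgk a hb
    have hi : aeval a (cf g k (g.degreeOf k)) ≠ 0 := hini k g (Or.inl hg) hgk a hb
    rw [← uni_coeff] at hi
    have hdeg : (uni a k g).natDegree = g.degreeOf k :=
      le_antisymm (uni_natDegree_le a k g) (Polynomial.le_natDegree_of_ne_zero hi)
    have hnd : (uni a k g).roots.Nodup :=
      Polynomial.nodup_roots (PerfectField.separable_iff_squarefree.2 hs)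
    have hcard : (uni a k g).roots.toFinset.card = g.degreeOf k := by
      rw [Multiset.toFinset_card_of_nodup hnd, ← hdeg]
      exact (IsAlgClosed.splits (uni a k g)).natDegree_eq_card_roots.symm
    refine Polynomial.eq_zero_of_natDegree_lt_card_of_eval_eq_zero' _
      (uni a k g).roots.toFinset ?_ ?_
    · intro t ht
      rw [uni_eval]
      refine hvan _ (SB_update S k a ha t ?_ ?_)
      · intro q hq hqk
        rw [ht1 k q (Or.inl hq) g (Or.inl hg) hqk hgk]
        exact Polynomial.isRoot_of_mem_roots (Multiset.mem_toFinset.1 ht)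
      · intro q hq hqk
        have e := ht1 k q (Or.inr hq) g (Or.inl hg) hqk hgk
        exact absurd ⟨e ▸ hg, hq⟩ (ht2 k q hqk)
    · rw [hcard]
      exact lt_of_le_of_lt (uni_natDegree_le a k p) (hred g hg hgk)
  · push Not at hE
    by_cases hI : ∃ g ∈ S.ineqs, IsLeader g k
    · obtain ⟨g, hg, hgk⟩ := hI
      have hs : Squarefree (uni a k g) := hsq k g (Or.inr hg) hgk a hb
      have hne : uni a k g ≠ 0 := hs.ne_zero
      have hz : uni a k p * uni a k g = 0 := by
        apply Polynomial.funext
        intro t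
        rw [Polynomial.eval_mul, Polynomial.eval_zero]
        by_cases h0 : (uni a k g).eval t = 0
        · rw [h0, mul_zero]
        · rw [uni_eval a k p, hvan _ (SB_update S k a ha t ?_ ?_), zero_mul]
          · exact fun q hq hqk => absurd hqk (hE q hq)
          · intro q hq hqk
            rwa [ht1 k q (Or.inr hq) g (Or.inr hg) hqk hgk]
      exact (mul_eq_zero.1 hz).resolve_right hne
    · push Not at hI
      apply Polynomial.funext
      intro t
      rw [Polynomial.eval_zero, uni_eval]
      exact hvan _ (SB_update S k a ha t (fun q hq hqk => absurd hqk (hE q hq))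
        (fun q hq hqk => absurd hqk (hI q hq)))

theorem main_aux (S : AlgSystem F n) (hS : Simple S) (k : ℕ) (hk : k ≤ n) :
    ∀ p : MvPolynomial (Fin n) F,
    (∀ i : Fin n, ∀ g ∈ S.eqs, IsLeader g i → p.degreeOf i < g.degreeOf i) →
    (∀ i ∈ p.vars, (i : ℕ) < k) →
    (∀ a : Fin n → AlgebraicClosure F, SB S k a → aeval a p = 0) → p = 0 := by
  induction k with
  | zero =>
    intro p _ hv hvan
    have h0 : p.vars = ∅ := Finset.eq_empty_of_forall_notMem fun i hi => by
      have := hv i hi; omega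
    obtain ⟨c, rfl⟩ : ∃ c, p = C c := ⟨_, vars_eq_empty_iff_eq_C.1 h0⟩
    have hne := hS.1.2.2
    have := hvan 0 ⟨fun q hq h => by
        obtain ⟨i, hi⟩ := hne q (Or.inl hq)
        have := h i hi; omega, fun q hq h => by
        obtain ⟨i, hi⟩ := hne q (Or.inr hq)
        have := h i hi; omega⟩
    simpa using this
  | succ k ih =>
    intro p hred hv hvan
    have hcf : ∀ j, cf p ⟨k, hk⟩ j = 0 := by
      intro j
      apply ih (by omega)
      · exact fun i g hg hgi => lt_of_le_of_lt (degreeOf_cf p _ j i) (hred i g hg hgi)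
      · intro i hi
        obtain ⟨h1, h2⟩ := vars_cf p _ j i hi
        have h3 := hv i h1
        have h5 : (i : ℕ) ≠ k := fun e => h2 (Fin.ext e)
        omega
      · intro a ha
        rw [← uni_coeff, uni_eq_zero S hS ⟨k, hk⟩ p (hred _) hvan a ha, Polynomial.coeff_zero]
    ext m
    rw [← coeff_cf p ⟨k, hk⟩ m, hcf, coeff_zero, coeff_zero]

/-- A polynomial that is reduced with respect to the equations of a simple system
(its degree in `x_k` is below `mdeg` of the equation of `S` with leader `x_k`, for
every such `k`) and vanishes on all solutions of the system is the zero polynomial. -/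
theorem reduced_and_vanishing_eq_zero (S : AlgSystem F n) (hS : Simple S)
    (p : MvPolynomial (Fin n) F)
    (hred : ∀ k : Fin n, ∀ g ∈ S.eqs, IsLeader g k → p.degreeOf k < g.degreeOf k)
    (hvan : ∀ a : Fin n → AlgebraicClosure F, Sol S a → aeval a p = 0) :
    p = 0 := by
  refine main_aux S hS n le_rfl p hred (fun i _ => i.2) fun a ha => hvan a ?_
  exact ⟨fun q hq => ha.1 q hq fun i _ => i.2, fun q hq => ha.2 q hq fun i _ => i.2⟩
end
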